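/- If (X,d,μ) is a metric measure space with μ doubling and (X,d) geodesic, then the map (x,y,z) ↦ R_{x,y}(z) is continuous on the domain D(R) := {(x,y,z) ∈ X³ : z ≠ x, x ≠ y, y ≠ z} (with values in [0,+∞]). -/

import Mathlib

open Metric MeasureTheory Filter Set Topology ENNReal NNReal
open scoped Classical

variable {X : Type*}

/-- The Riesz potential with poles `x, y`. -/
noncomputable def rieszPotential [MetricSpace X] [MeasurableSpace X]
    (μ : Measure X) (x y z : X) : ℝ≥0∞ :=
  if z = x ∨ z = y then 0
  else ENNReal.ofReal (dist x z) / μ (ball x (dist x z)) +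
    ENNReal.ofReal (dist y z) / μ (ball y (dist y z))

/-- The `L`-truncated Riesz potential with poles `x, y`. -/
noncomputable def truncRiesz [MetricSpace X] [MeasurableSpace X]
    (μ : Measure X) (x y : X) (L : ℝ) : X → ℝ≥0∞ :=
  (ball x (2 * L * dist x y) ∪ ball y (2 * L * dist x y)).indicator (rieszPotential μ x y)

/-- The Riesz measure `m^L_{x,y} = R^L_{x,y} · μ`. -/
noncomputable def rieszMeasure [MetricSpace X] [MeasurableSpace X]
    (μ : Measure X) (x y : X) (L : ℝ) : Measure X :=
  μ.withDensity (truncRiesz μ x y L)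

/-- `μ` is a `C`-doubling measure. -/
def IsDoublingWith [MetricSpace X] [MeasurableSpace X] (μ : Measure X) (C : ℝ≥0) : Prop :=
  ∀ (z : X) (r : ℝ), 0 < r → μ (ball z (2 * r)) ≤ C * μ (ball z r)

/-- `X` is a geodesic space: any two points are joined by a curve whose length equals their
distance. -/
def IsGeodesicSpace (X : Type*) [MetricSpace X] : Prop :=
  ∀ x y : X, ∃ γ : ℝ → X, ContinuousOn γ (Set.Icc 0 1) ∧ γ 0 = x ∧ γ 1 = y ∧
    eVariationOn γ (Set.Icc 0 1) = ENNReal.ofReal (dist x y)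

theorem IsGeodesicSpace.exists_dist_eq [MetricSpace X] (hgeo : IsGeodesicSpace X) (y x : X)
    {t : ℝ} (ht : t ∈ Icc 0 (dist y x)) : ∃ p : X, dist y p = t ∧ dist p x ≤ dist y x - t := by
  obtain ⟨γ, hγ, h0, h1, hlen⟩ := hgeo y x
  have hcont : ContinuousOn (fun s => dist y (γ s)) (Icc (0 : ℝ) 1) :=
    continuous_dist.comp_continuousOn (continuousOn_const.prodMk hγ)
  obtain ⟨s, hs, rfl⟩ : t ∈ (fun s => dist y (γ s)) '' Icc (0 : ℝ) 1 :=
    intermediate_value_Icc zero_le_one hcont (by simpa [h0, h1] using ht)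
  refine ⟨γ s, rfl, ?_⟩
  have hsplit : eVariationOn γ (Icc 0 s) + eVariationOn γ (Icc s 1) = eVariationOn γ (Icc 0 1) := by
    simpa using eVariationOn.Icc_add_Icc γ hs.1 hs.2 (mem_univ s)
  have hleft : edist y (γ s) ≤ eVariationOn γ (Icc 0 s) :=
    h0 ▸ eVariationOn.edist_le γ (left_mem_Icc.2 hs.1) (right_mem_Icc.2 hs.1)
  have hright : edist (γ s) x ≤ eVariationOn γ (Icc s 1) :=
    h1 ▸ eVariationOn.edist_le γ (left_mem_Icc.2 hs.2) (right_mem_Icc.2 hs.2)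
  have hsum := (add_le_add hleft hright).trans_eq (hsplit.trans hlen)
  rw [edist_dist, edist_dist, ← ENNReal.ofReal_add dist_nonneg dist_nonneg,
    ENNReal.ofReal_le_ofReal_iff dist_nonneg] at hsum
  linarith

theorem IsDoublingWith.measure_ball_four_mul_le [MetricSpace X] [MeasurableSpace X]
    {μ : Measure X} {C : ℝ≥0} (hD : IsDoublingWith μ C) (z : X) {r : ℝ} (hr : 0 < r) :
    μ (ball z (4 * r)) ≤ (C * C : ℝ≥0) * μ (ball z r) := by
  calc μ (ball z (4 * r)) = μ (ball z (2 * (2 * r))) := by ring_nf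
    _ ≤ C * μ (ball z (2 * r)) := hD z _ (by positivity)
    _ ≤ C * (C * μ (ball z r)) := by gcongr; exact hD z r hr
    _ = (C * C : ℝ≥0) * μ (ball z r) := by push_cast; ring

theorem IsDoublingWith.isUnifLocDoublingMeasure [MetricSpace X] [MeasurableSpace X]
    {μ : Measure X} {C : ℝ≥0} (hD : IsDoublingWith μ C) : IsUnifLocDoublingMeasure μ := by
  refine ⟨C * C, ?_⟩
  filter_upwards [self_mem_nhdsWithin] with ε hε z
  have hε : 0 < ε := hε
  calc μ (closedBall z (2 * ε)) ≤ μ (ball z (4 * ε)) := by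
        gcongr; exact closedBall_subset_ball (by linarith)
    _ ≤ (C * C : ℝ≥0) * μ (ball z ε) := hD.measure_ball_four_mul_le z hε
    _ ≤ (C * C : ℝ≥0) * μ (closedBall z ε) := by gcongr; exact ball_subset_closedBall

theorem IsDoublingWith.measure_sphere_eq_zero [MetricSpace X] [SecondCountableTopology X]
    [MeasurableSpace X] [BorelSpace X] {μ : Measure X} [IsLocallyFiniteMeasure μ]
    (hfin : ∀ s : Set X, Bornology.IsBounded s → μ s ≠ ⊤)
    {C : ℝ≥0} (hD : IsDoublingWith μ C) (hgeo : IsGeodesicSpace X) (x : X) {r : ℝ} (hr : 0 < r) :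
    μ (sphere x r) = 0 := by
  have := hD.isUnifLocDoublingMeasure
  set K : ℝ≥0 := C * C
  by_contra hpos
  obtain ⟨y, hy, hyS⟩ := (((ae_restrict_iff' isClosed_sphere.measurableSet).1
    (IsUnifLocDoublingMeasure.ae_tendsto_measure_inter_div μ (sphere x r) 1)).and_frequently
      (frequently_ae_mem_iff.2 hpos)).exists
  have hlim := hy hyS (fun _ : ℝ => y) id (l := 𝓝[>] 0) tendsto_id
    (by filter_upwards [self_mem_nhdsWithin] with δ hδ
        simpa using (le_of_lt hδ : (0 : ℝ) ≤ δ))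
  have hbound : ∀ᶠ δ : ℝ in 𝓝[>] 0,
      K * (μ (sphere x r ∩ closedBall y δ) / μ (closedBall y δ)) + 1 ≤ (K : ℝ≥0∞) := by
    filter_upwards [self_mem_nhdsWithin, hlim.eventually_ne one_ne_zero,
      nhdsWithin_le_nhds (Iio_mem_nhds hr)] with δ hδ hne hδr
    have hδ : 0 < δ := hδ
    have hδr : δ < r := hδr
    have hfinB : μ (closedBall y δ) ≠ ⊤ := hfin _ isBounded_closedBall
    have hB : μ (closedBall y δ) ≠ 0 := fun h =>
      hne (by simp [measure_mono_null inter_subset_right h])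
    have hyx : dist y x = r := hyS
    obtain ⟨p, hyp, hpx⟩ := hgeo.exists_dist_eq y x (t := δ / 2)
      ⟨by positivity, by linarith⟩
    have hdisj : Disjoint (sphere x r ∩ closedBall y δ) (ball p (δ / 2)) := by
      refine Set.disjoint_left.2 fun q hq hqp => ?_
      have h1 : dist q x = r := hq.1
      have h2 : dist q p < δ / 2 := hqp
      linarith [dist_triangle q p x]
    have hsub : sphere x r ∩ closedBall y δ ∪ ball p (δ / 2) ⊆ closedBall y δ := by
      refine union_subset inter_subset_right fun q hq => ?_
      have h2 : dist q p < δ / 2 := hq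
      rw [mem_closedBall]
      linarith [dist_triangle q p y, dist_comm p y]
    have hadd : μ (sphere x r ∩ closedBall y δ) + μ (ball p (δ / 2)) ≤ μ (closedBall y δ) := by
      rw [← measure_union hdisj measurableSet_ball]
      exact measure_mono hsub
    have hdoub : μ (closedBall y δ) ≤ K * μ (ball p (δ / 2)) := by
      refine (measure_mono fun q hq => ?_).trans
        (hD.measure_ball_four_mul_le p (half_pos hδ))
      have h2 : dist q y ≤ δ := hq
      rw [mem_ball]
      linarith [dist_triangle q y p]
    rw [← mul_div_assoc, ← ENNReal.div_self hB hfinB, ← ENNReal.add_div]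
    refine ENNReal.div_le_of_le_mul ?_
    calc K * μ (sphere x r ∩ closedBall y δ) + μ (closedBall y δ)
        ≤ K * μ (sphere x r ∩ closedBall y δ) + K * μ (ball p (δ / 2)) := by gcongr
      _ = K * (μ (sphere x r ∩ closedBall y δ) + μ (ball p (δ / 2))) := by ring
      _ ≤ K * μ (closedBall y δ) := by gcongr
  have hle : (K : ℝ≥0∞) * 1 + 1 ≤ K :=
    le_of_tendsto ((ENNReal.Tendsto.const_mul hlim (Or.inl one_ne_zero)).add_const 1) hbound
  rw [mul_one] at hle
  exact (ENNReal.lt_add_right ENNReal.coe_ne_top one_ne_zero).not_ge hle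

theorem IsDoublingWith.tendsto_measure_ball [MetricSpace X] [SecondCountableTopology X]
    [MeasurableSpace X] [BorelSpace X] {μ : Measure X} [IsLocallyFiniteMeasure μ]
    (hfin : ∀ s : Set X, Bornology.IsBounded s → μ s ≠ ⊤)
    {C : ℝ≥0} (hD : IsDoublingWith μ C) (hgeo : IsGeodesicSpace X) (x : X) {r : ℝ} (hr : 0 < r) :
    Tendsto (fun a : X × ℝ => μ (ball a.1 a.2)) (𝓝 (x, r)) (𝓝 (μ (ball x r))) := by
  refine tendsto_measure_of_ae_tendsto_indicator (𝓝 (x, r)) measurableSet_ball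
    (fun _ => measurableSet_ball) (measurableSet_ball (x := x) (ε := r + 2))
    (hfin _ isBounded_ball) ?_ ?_
  · have hev : ∀ᶠ a : X × ℝ in 𝓝 (x, r), dist a.1 x + a.2 < r + 2 :=
      ContinuousAt.eventually_lt (by fun_prop) continuousAt_const (by simp)
    filter_upwards [hev] with a ha
    exact ball_subset_ball' (by linarith)
  · filter_upwards [measure_eq_zero_iff_ae_notMem.1
      (hD.measure_sphere_eq_zero hfin hgeo x hr)] with q hq
    rcases lt_or_gt_of_ne (show dist q x ≠ r from hq) with h | h
    · have hev : ∀ᶠ a : X × ℝ in 𝓝 (x, r), dist q a.1 < a.2 :=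
        ContinuousAt.eventually_lt (by fun_prop) (by fun_prop) h
      filter_upwards [hev] with a ha
      simp [ha, h]
    · have hev : ∀ᶠ a : X × ℝ in 𝓝 (x, r), a.2 < dist q a.1 :=
        ContinuousAt.eventually_lt (by fun_prop) (by fun_prop) h
      filter_upwards [hev] with a ha
      exact iff_of_false ha.not_gt h.not_gt

theorem IsDoublingWith.tendsto_ofReal_dist_div_measure_ball [MetricSpace X]
    [SecondCountableTopology X] [MeasurableSpace X] [BorelSpace X] {μ : Measure X}
    [IsLocallyFiniteMeasure μ] (hfin : ∀ s : Set X, Bornology.IsBounded s → μ s ≠ ⊤)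
    {C : ℝ≥0} (hD : IsDoublingWith μ C) (hgeo : IsGeodesicSpace X) {x z : X} (hxz : x ≠ z) :
    Tendsto (fun a : X × X => ENNReal.ofReal (dist a.1 a.2) / μ (ball a.1 (dist a.1 a.2)))
      (𝓝 (x, z)) (𝓝 (ENNReal.ofReal (dist x z) / μ (ball x (dist x z)))) := by
  have hr : 0 < dist x z := dist_pos.2 hxz
  have hnum : Continuous fun a : X × X => ENNReal.ofReal (dist a.1 a.2) :=
    ENNReal.continuous_ofReal.comp continuous_dist
  have harg : Continuous fun a : X × X => (a.1, dist a.1 a.2) := by fun_prop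
  exact ENNReal.Tendsto.div (hnum.tendsto _) (Or.inl (by simpa using hxz))
    ((hD.tendsto_measure_ball hfin hgeo x hr).comp (harg.tendsto (x, z)))
    (Or.inr ENNReal.ofReal_ne_top)

/-- On a geodesic doubling metric measure space, the Riesz potential is continuous on
`D(R) = {(x,y,z) : z ≠ x, x ≠ y, y ≠ z}`. -/
theorem rieszPotential_continuousOn
    [MetricSpace X] [CompleteSpace X] [TopologicalSpace.SeparableSpace X]
    [MeasurableSpace X] [BorelSpace X]
    (μ : Measure X) (hfin : ∀ s : Set X, Bornology.IsBounded s → μ s ≠ ⊤)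
    (C_D : ℝ≥0) (hD : IsDoublingWith μ C_D)
    (hgeo : IsGeodesicSpace X) :
    ContinuousOn (fun w : X × X × X => rieszPotential μ w.1 w.2.1 w.2.2)
      {w : X × X × X | w.2.2 ≠ w.1 ∧ w.1 ≠ w.2.1 ∧ w.2.1 ≠ w.2.2} := by
  have : SecondCountableTopology X := UniformSpace.secondCountable_of_separable X
  have : IsLocallyFiniteMeasure μ :=
    ⟨fun x => ⟨ball x 1, ball_mem_nhds x one_pos, (hfin _ isBounded_ball).lt_top⟩⟩
  have hcongr : EqOn (fun w : X × X × X => rieszPotential μ w.1 w.2.1 w.2.2)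
      (fun w => ENNReal.ofReal (dist w.1 w.2.2) / μ (ball w.1 (dist w.1 w.2.2)) +
        ENNReal.ofReal (dist w.2.1 w.2.2) / μ (ball w.2.1 (dist w.2.1 w.2.2)))
      {w : X × X × X | w.2.2 ≠ w.1 ∧ w.1 ≠ w.2.1 ∧ w.2.1 ≠ w.2.2} := fun w hw => by
    simp only [rieszPotential, if_neg (not_or.2 ⟨hw.1, hw.2.2.symm⟩)]
  refine ContinuousOn.congr (fun w hw => ContinuousAt.continuousWithinAt ?_) hcongr
  have hx : Continuous fun w : X × X × X => (w.1, w.2.2) := by fun_prop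
  have hy : Continuous fun w : X × X × X => (w.2.1, w.2.2) := by fun_prop
  exact ((hD.tendsto_ofReal_dist_div_measure_ball hfin hgeo hw.1.symm).comp (hx.tendsto w)).add
    ((hD.tendsto_ofReal_dist_div_measure_ball hfin hgeo hw.2.2).comp (hy.tendsto w))
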